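/- arXiv:hep-th/0210087 — 2 statements merged into one kernel-verified Lean document; each statement's English description precedes it below -/
import Mathlib

section
/- For every integer P ≥ 1, every p ∈ ℕ and every q ∈ ℂ with q ≠ 0, the constant matrices R and S = R^{ι^p} satisfy the second modified Yang–Baxter equation S₁₂·R₁₃·S₂₃ = R₂₃·S₁₃·R₁₂, an equality of operators on ℂ²⊗ℂ²⊗ℂ². -/
open Complex

/-- Index type for `ℂ²⊗ℂ²` with ordered basis `(e₀⊗e₀, e₀⊗e₁, e₁⊗e₀, e₁⊗e₁)`. -/
abbrev V2 : Type := Fin 2 × Fin 2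

/-- Index type for `ℂ²⊗ℂ²⊗ℂ²`. -/
abbrev V3 : Type := Fin 2 × Fin 2 × Fin 2

/-- The constant `R`-matrix `R^{ι^p}`: nonzero entries
`[1,1] = [4,4] = q`, `[2,2] = ε^p`, `[3,3] = ε^{−p}`, `[3,2] = q − q⁻¹`. -/
noncomputable def Rconst (ε q : ℂ) (p : ℕ) : Matrix V2 V2 ℂ :=
  Matrix.of fun x y =>
    if x = (0, 0) ∧ y = (0, 0) then q
    else if x = (1, 1) ∧ y = (1, 1) then q
    else if x = (0, 1) ∧ y = (0, 1) then ε ^ p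
    else if x = (1, 0) ∧ y = (1, 0) then (ε ^ p)⁻¹
    else if x = (1, 0) ∧ y = (0, 1) then q - q⁻¹
    else 0

/-- The spectral-parameter dependent `R`-matrix `R^{ι^p}(u)`: nonzero entries
`[1,1] = [4,4] = sin(λ+u)`, `[2,2] = ε^p·sin u`, `[3,3] = ε^{−p}·sin u`,
`[2,3] = e^{−iu}·sin λ`, `[3,2] = e^{iu}·sin λ`. -/
noncomputable def Rspec (ε lam : ℂ) (p : ℕ) (u : ℂ) : Matrix V2 V2 ℂ :=
  Matrix.of fun x y =>
    if x = (0, 0) ∧ y = (0, 0) then Complex.sin (lam + u)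
    else if x = (1, 1) ∧ y = (1, 1) then Complex.sin (lam + u)
    else if x = (0, 1) ∧ y = (0, 1) then ε ^ p * Complex.sin u
    else if x = (1, 0) ∧ y = (1, 0) then (ε ^ p)⁻¹ * Complex.sin u
    else if x = (0, 1) ∧ y = (1, 0) then Complex.exp (-(Complex.I * u)) * Complex.sin lam
    else if x = (1, 0) ∧ y = (0, 1) then Complex.exp (Complex.I * u) * Complex.sin lam
    else 0

/-- The flip operator `Π` on `ℂ²⊗ℂ²`. -/
def flipM : Matrix V2 V2 ℂ :=
  Matrix.of fun x y => if x.1 = y.2 ∧ x.2 = y.1 then 1 else 0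

/-- `X_{12}`: `X` acting on tensor factors 1 and 2 of `ℂ²⊗ℂ²⊗ℂ²`. -/
def op12 (X : Matrix V2 V2 ℂ) : Matrix V3 V3 ℂ :=
  Matrix.of fun x y => X (x.1, x.2.1) (y.1, y.2.1) * (if x.2.2 = y.2.2 then 1 else 0)

/-- `X_{13}`: `X` acting on tensor factors 1 and 3. -/
def op13 (X : Matrix V2 V2 ℂ) : Matrix V3 V3 ℂ :=
  Matrix.of fun x y => X (x.1, x.2.2) (y.1, y.2.2) * (if x.2.1 = y.2.1 then 1 else 0)

/-- `X_{23}`: `X` acting on tensor factors 2 and 3. -/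
def op23 (X : Matrix V2 V2 ℂ) : Matrix V3 V3 ℂ :=
  Matrix.of fun x y => X (x.2.1, x.2.2) (y.2.1, y.2.2) * (if x.1 = y.1 then 1 else 0)

/-- `X_{21}`: first matrix index of `X` on factor 2, second on factor 1. -/
def op21 (X : Matrix V2 V2 ℂ) : Matrix V3 V3 ℂ :=
  Matrix.of fun x y => X (x.2.1, x.1) (y.2.1, y.1) * (if x.2.2 = y.2.2 then 1 else 0)

/-- `X_{31}`: first matrix index of `X` on factor 3, second on factor 1. -/
def op31 (X : Matrix V2 V2 ℂ) : Matrix V3 V3 ℂ :=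
  Matrix.of fun x y => X (x.2.2, x.1) (y.2.2, y.1) * (if x.2.1 = y.2.1 then 1 else 0)

/-- `X_{32}`: first matrix index of `X` on factor 3, second on factor 2. -/
def op32 (X : Matrix V2 V2 ℂ) : Matrix V3 V3 ℂ :=
  Matrix.of fun x y => X (x.2.2, x.2.1) (y.2.2, y.2.1) * (if x.1 = y.1 then 1 else 0)

lemma op12_mul_op13_mul_op23_apply (X Y Z : Matrix V2 V2 ℂ) (a b c d e f : Fin 2) :
    (op12 X * op13 Y * op23 Z) (a, b, c) (d, e, f) =
      ∑ i, ∑ j, ∑ k, X (a, b) (i, j) * Y (i, c) (d, k) * Z (j, k) (e, f) := by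
  simp [op12, op13, op23, Matrix.mul_apply, Fintype.sum_prod_type]
  ring

lemma op23_mul_op13_mul_op12_apply (X Y Z : Matrix V2 V2 ℂ) (a b c d e f : Fin 2) :
    (op23 X * op13 Y * op12 Z) (a, b, c) (d, e, f) =
      ∑ i, ∑ j, ∑ k, X (b, c) (j, k) * Y (a, k) (i, f) * Z (i, j) (d, e) := by
  simp [op12, op13, op23, Matrix.mul_apply, Fintype.sum_prod_type]
  ring

set_option maxHeartbeats 4000000 in
/-- Second modified Yang–Baxter equation for the constant matrices `R = R^{ι^0}`
and `S = R^{ι^p}`:  `S₁₂·R₁₃·S₂₃ = R₂₃·S₁₃·R₁₂` on `ℂ²⊗ℂ²⊗ℂ²`. -/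
theorem stmt3 (P : ℕ) (hP : 1 ≤ P) (p : ℕ) (q : ℂ) (hq : q ≠ 0)
    (ε : ℂ) (hε : ε = Complex.exp (2 * Real.pi * Complex.I / P)) :
    op12 (Rconst ε q p) * op13 (Rconst ε q 0) * op23 (Rconst ε q p) =
      op23 (Rconst ε q 0) * op13 (Rconst ε q p) * op12 (Rconst ε q 0) := by
  have hp : ε ^ p ≠ 0 := pow_ne_zero p (hε ▸ Complex.exp_ne_zero _)
  ext ⟨a, b, c⟩ ⟨d, e, f⟩
  rw [op12_mul_op13_mul_op23_apply, op23_mul_op13_mul_op12_apply]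
  fin_cases a <;> fin_cases b <;> fin_cases c <;> fin_cases d <;> fin_cases e <;> fin_cases f <;>
    simp [Rconst] <;> grind
end

section
/- For every integer P ≥ 1, every p ∈ ℕ and every q ∈ ℂ with q ≠ 0, the constant matrices R and S = R^{ι^p} satisfy the fourth modified Yang–Baxter equation S₁₂·(R₃₁)^{−1}·S₂₃ − (S₂₁)^{−1}·R₁₃·(S₃₂)^{−1} = R₂₃·(S₃₁)^{−1}·R₁₂ − (R₃₂)^{−1}·S₁₃·(R₂₁)^{−1}, an equality of operators on ℂ²⊗ℂ²⊗ℂ² (all the indicated operators on ℂ²⊗ℂ²⊗ℂ² are invertible since q ≠ 0, and the inverses are operator inverses). -/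
open Complex

theorem Rconst_mul_Rconst_inv {ε q : ℂ} (hε : ε ≠ 0) (hq : q ≠ 0) (p : ℕ) :
    Rconst ε q p * Rconst ε⁻¹ q⁻¹ p = 1 := by
  have hp : ε ^ p ≠ 0 := pow_ne_zero p hε
  ext ⟨a, b⟩ ⟨c, d⟩
  fin_cases a <;> fin_cases b <;> fin_cases c <;> fin_cases d <;>
    simp [Rconst, Matrix.mul_apply, Fintype.sum_prod_type, hq, hp]
  all_goals (field_simp; ring)

theorem op21_mul (X Y : Matrix V2 V2 ℂ) : op21 (X * Y) = op21 X * op21 Y := by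
  ext ⟨a, b, c⟩ ⟨d, e, f⟩
  by_cases h : c = f
  · simp [op21, Matrix.mul_apply, Fintype.sum_prod_type, h]
    ring
  · simp [op21, Matrix.mul_apply, Fintype.sum_prod_type, h]

theorem op21_one : op21 1 = 1 := by
  ext ⟨a, b, c⟩ ⟨d, e, f⟩
  simp only [op21, Matrix.of_apply, Matrix.one_apply, Prod.mk.injEq, mul_ite, mul_one, mul_zero]
  split_ifs <;> simp_all

theorem op21_Rconst_inv {ε q : ℂ} (hε : ε ≠ 0) (hq : q ≠ 0) (p : ℕ) :
    (op21 (Rconst ε q p))⁻¹ = op21 (Rconst ε⁻¹ q⁻¹ p) :=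
  Matrix.inv_eq_right_inv <| by
    rw [← op21_mul, Rconst_mul_Rconst_inv hε hq, op21_one]

theorem op31_mul (X Y : Matrix V2 V2 ℂ) : op31 (X * Y) = op31 X * op31 Y := by
  ext ⟨a, b, c⟩ ⟨d, e, f⟩
  by_cases h : b = e
  · simp [op31, Matrix.mul_apply, Fintype.sum_prod_type, h]
    ring
  · simp [op31, Matrix.mul_apply, Fintype.sum_prod_type, h]

theorem op31_one : op31 1 = 1 := by
  ext ⟨a, b, c⟩ ⟨d, e, f⟩
  simp only [op31, Matrix.of_apply, Matrix.one_apply, Prod.mk.injEq, mul_ite, mul_one, mul_zero]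
  split_ifs <;> simp_all

theorem op31_Rconst_inv {ε q : ℂ} (hε : ε ≠ 0) (hq : q ≠ 0) (p : ℕ) :
    (op31 (Rconst ε q p))⁻¹ = op31 (Rconst ε⁻¹ q⁻¹ p) :=
  Matrix.inv_eq_right_inv <| by
    rw [← op31_mul, Rconst_mul_Rconst_inv hε hq, op31_one]

theorem op32_mul (X Y : Matrix V2 V2 ℂ) : op32 (X * Y) = op32 X * op32 Y := by
  ext ⟨a, b, c⟩ ⟨d, e, f⟩
  by_cases h : a = d
  · simp [op32, Matrix.mul_apply, Fintype.sum_prod_type, h]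
    ring
  · simp [op32, Matrix.mul_apply, Fintype.sum_prod_type, h]

theorem op32_one : op32 1 = 1 := by
  ext ⟨a, b, c⟩ ⟨d, e, f⟩
  simp only [op32, Matrix.of_apply, Matrix.one_apply, Prod.mk.injEq, mul_ite, mul_one, mul_zero]
  split_ifs <;> simp_all

theorem op32_Rconst_inv {ε q : ℂ} (hε : ε ≠ 0) (hq : q ≠ 0) (p : ℕ) :
    (op32 (Rconst ε q p))⁻¹ = op32 (Rconst ε⁻¹ q⁻¹ p) :=
  Matrix.inv_eq_right_inv <| by
    rw [← op32_mul, Rconst_mul_Rconst_inv hε hq, op32_one]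

theorem op12_mul_op31_mul_op23_apply (X Y Z : Matrix V2 V2 ℂ) (a b c d e f : Fin 2) :
    (op12 X * op31 Y * op23 Z) (a, b, c) (d, e, f) =
      ∑ u, ∑ v, ∑ w, X (a, b) (u, v) * Y (c, u) (w, d) * Z (v, w) (e, f) := by
  simp [op12, op31, op23, Matrix.mul_apply, Fintype.sum_prod_type, Fin.sum_univ_two]
  ring

theorem op21_mul_op13_mul_op32_apply (X Y Z : Matrix V2 V2 ℂ) (a b c d e f : Fin 2) :
    (op21 X * op13 Y * op32 Z) (a, b, c) (d, e, f) =
      ∑ u, ∑ v, ∑ w, X (b, a) (u, v) * Y (v, c) (d, w) * Z (w, u) (f, e) := by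
  simp [op21, op13, op32, Matrix.mul_apply, Fintype.sum_prod_type, Fin.sum_univ_two]
  ring

theorem op23_mul_op31_mul_op12_apply (X Y Z : Matrix V2 V2 ℂ) (a b c d e f : Fin 2) :
    (op23 X * op31 Y * op12 Z) (a, b, c) (d, e, f) =
      ∑ u, ∑ v, ∑ w, X (b, c) (u, v) * Y (v, a) (f, w) * Z (w, u) (d, e) := by
  simp [op23, op31, op12, Matrix.mul_apply, Fintype.sum_prod_type, Fin.sum_univ_two]
  ring

theorem op32_mul_op13_mul_op21_apply (X Y Z : Matrix V2 V2 ℂ) (a b c d e f : Fin 2) :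
    (op32 X * op13 Y * op21 Z) (a, b, c) (d, e, f) =
      ∑ u, ∑ v, ∑ w, X (c, b) (u, v) * Y (a, u) (w, f) * Z (v, w) (e, d) := by
  simp [op32, op13, op21, Matrix.mul_apply, Fintype.sum_prod_type, Fin.sum_univ_two]
  ring

set_option maxHeartbeats 1000000 in
/-- Fourth modified Yang–Baxter equation for the constant matrices `R = R^{ι^0}`
and `S = R^{ι^p}`:
`S₁₂·(R₃₁)⁻¹·S₂₃ − (S₂₁)⁻¹·R₁₃·(S₃₂)⁻¹ = R₂₃·(S₃₁)⁻¹·R₁₂ − (R₃₂)⁻¹·S₁₃·(R₂₁)⁻¹`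
on `ℂ²⊗ℂ²⊗ℂ²`, the inverses being operator inverses. -/
theorem stmt5 (P : ℕ) (hP : 1 ≤ P) (p : ℕ) (q : ℂ) (hq : q ≠ 0)
    (ε : ℂ) (hε : ε = Complex.exp (2 * Real.pi * Complex.I / P)) :
    op12 (Rconst ε q p) * (op31 (Rconst ε q 0))⁻¹ * op23 (Rconst ε q p) -
        (op21 (Rconst ε q p))⁻¹ * op13 (Rconst ε q 0) * (op32 (Rconst ε q p))⁻¹ =
      op23 (Rconst ε q 0) * (op31 (Rconst ε q p))⁻¹ * op12 (Rconst ε q 0) -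
        (op32 (Rconst ε q 0))⁻¹ * op13 (Rconst ε q p) * (op21 (Rconst ε q 0))⁻¹ := by
  have hε0 : ε ≠ 0 := hε ▸ Complex.exp_ne_zero _
  have hp : ε ^ p ≠ 0 := pow_ne_zero p hε0
  simp only [op21_Rconst_inv hε0 hq, op31_Rconst_inv hε0 hq, op32_Rconst_inv hε0 hq]
  ext ⟨a, b, c⟩ ⟨d, e, f⟩
  simp only [Matrix.sub_apply, op12_mul_op31_mul_op23_apply,
    op21_mul_op13_mul_op32_apply,
    op23_mul_op31_mul_op12_apply,
    op32_mul_op13_mul_op21_apply,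
    Fin.sum_univ_two]
  fin_cases a <;> fin_cases b <;> fin_cases c <;> fin_cases d <;> fin_cases e <;> fin_cases f <;>
    simp [Rconst]
  all_goals (field_simp; try ring)
end
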